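/- Let P be a monic unilateral polynomial over the coquaternions 𝕊 with companion polynomial C_P = conj(P) P, let r₁ ∈ ℝ be a simple root of C_P (root of multiplicity exactly 1), and let r ∈ ℝ with C_P(r) ≠ 0. Then the polynomial P_r(x) = P(x)(x − r) has a linear zero in the quasi-similarity class of p = (r + r₁)/2 + ((r − r₁)/2) j: the set of z ∈ 𝕊 with re(z) = (r + r₁)/2, det(z) = r·r₁ and P_r(z) = 0 is infinite, yet there exists w ∈ 𝕊 with re(w) = (r + r₁)/2 and det(w) = r·r₁ which is not a zero of P_r. -/

import Mathlib

open Quaternion Polynomial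

noncomputable section

/-- The real algebra of coquaternions (split quaternions):
basis `1, i, j, k` with `i² = -1`, `j² = k² = 1`, `ij = -ji = k`. -/
abbrev CoQ : Type := ℍ[ℝ, -1, 1]

/-- The determinant of a coquaternion: `det q = q₀² + q₁² - q₂² - q₃²` (equals `q * star q`). -/
def coDet (q : CoQ) : ℝ := q.re ^ 2 + q.imI ^ 2 - q.imJ ^ 2 - q.imK ^ 2

/-- The conjugate polynomial: coefficients are conjugated (`star`) coefficientwise. -/
def pconj (P : Polynomial CoQ) : Polynomial CoQ := ⟨⟨P.toFinsupp.coeff.mapRange star (star_zero _)⟩⟩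

lemma coeff_pconj (P : Polynomial CoQ) (n : ℕ) : (pconj P).coeff n = star (P.coeff n) := rfl

lemma eval_pconj_real (P : Polynomial CoQ) (a : ℝ) :
    (pconj P).eval (a : CoQ) = star (P.eval (a : CoQ)) := by
  have hadd (p q : Polynomial CoQ) : pconj (p + q) = pconj p + pconj q := by
    ext1 n
    simp [coeff_pconj]
  have hmono (n : ℕ) (b : CoQ) : pconj (monomial n b) = monomial n (star b) := by
    ext1 m
    simp only [coeff_pconj, coeff_monomial]
    split_ifs <;> simp
  induction P using Polynomial.induction_on' with
  | add p q hp hq => rw [hadd, eval_add, eval_add, hp, hq, star_add]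
  | monomial n b =>
    rw [hmono, eval_monomial, eval_monomial, star_mul, ← QuaternionAlgebra.coe_pow,
      QuaternionAlgebra.star_coe, QuaternionAlgebra.coe_commutes]

lemma eval_mul_real (P Q : Polynomial CoQ) (a : ℝ) :
    (P * Q).eval (a : CoQ) = P.eval (a : CoQ) * Q.eval (a : CoQ) :=
  eval₂_mul_noncomm _ _ fun _ => (QuaternionAlgebra.coe_commutes a _).symm

lemma commute_X_sub_C_real (P : Polynomial CoQ) (a : ℝ) : Commute (X - C (a : CoQ)) P := by
  refine (commute_X P).sub_left ?_
  ext1 n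
  simp only [coeff_C_mul, coeff_mul_C]
  exact QuaternionAlgebra.coe_commutes a _

lemma X_sub_C_real_dvd_of_eval_eq_zero {P : Polynomial CoQ} {a : ℝ}
    (h : P.eval (a : CoQ) = 0) : X - C (a : CoQ) ∣ P := by
  have key (Q : Polynomial CoQ) : X - C (a : CoQ) ∣ Q - C (Q.eval (a : CoQ)) := by
    induction Q using Polynomial.induction_on' with
    | add p q hp hq =>
      rw [eval_add, C_add, add_sub_add_comm]
      exact dvd_add hp hq
    | monomial n b =>
      obtain ⟨S, hS⟩ := (commute_X (C (a : CoQ))).sub_dvd_pow_sub_pow n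
      refine ⟨C b * S, ?_⟩
      rw [← mul_assoc, (commute_X_sub_C_real (C b) a).eq, mul_assoc, ← hS, mul_sub,
        eval_monomial, C_mul, C_pow, C_mul_X_pow_eq_monomial]
  simpa [h] using key P

lemma X_sub_C_real_dvd_pconj {P : Polynomial CoQ} {a : ℝ}
    (h : X - C (a : CoQ) ∣ P) : X - C (a : CoQ) ∣ pconj P := by
  apply X_sub_C_real_dvd_of_eval_eq_zero
  obtain ⟨Q, rfl⟩ := h
  simp [eval_pconj_real, eval_mul_real]

lemma eval_mul_eq_eval_real_mul (P : Polynomial CoQ) {a : ℝ} {z y : CoQ} (h : z * y = a * y) :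
    P.eval z * y = P.eval (a : CoQ) * y := by
  have hpow (n : ℕ) : z ^ n * y = (a : CoQ) ^ n * y := by
    induction n with
    | zero => simp
    | succ n ih =>
      rw [pow_succ, mul_assoc, h, ← mul_assoc, ← QuaternionAlgebra.coe_commutes, mul_assoc, ih,
        ← mul_assoc, ← pow_succ']
  induction P using Polynomial.induction_on' with
  | add p q hp hq => rw [eval_add, eval_add, add_mul, add_mul, hp, hq]
  | monomial n b => rw [eval_monomial, eval_monomial, mul_assoc, hpow, mul_assoc]

lemma eval_mul_X_sub_C_real (P : Polynomial CoQ) (r r₁ : ℝ) {z : CoQ}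
    (hre : z.re = (r + r₁) / 2) (hdet : coDet z = r * r₁) :
    (P * (X - C (r : CoQ))).eval z = P.eval (r₁ : CoQ) * (z - r) := by
  rw [← eval_mul_eq_eval_real_mul P (z := z)]
  · rw [← (commute_X_sub_C_real P r).eq, sub_mul, eval_sub, X_mul, eval_mul_X, eval_C_mul,
      QuaternionAlgebra.coe_commutes, mul_sub]
  · rw [coDet, hre] at hdet
    ext <;> simp [hre] <;> linarith

lemma coDet_eq_zero_of_star_mul_self {q : CoQ} (h : star q * q = 0) : coDet q = 0 := by
  have := congrArg QuaternionAlgebra.re h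
  simp at this
  rw [coDet]
  linarith

lemma exists_line_of_coDet_eq_zero {q : CoQ} (hq : q ≠ 0) (hdet : coDet q = 0) :
    ∃ c e : ℝ, c ^ 2 + e ^ 2 = 1 ∧
      ∀ t : ℝ, q * (⟨1, t, -c - t * e, t * c - e⟩ : CoQ) = 0 := by
  obtain ⟨a, b, c, d⟩ := q
  simp only [coDet] at hdet
  have hs : a ^ 2 + b ^ 2 ≠ 0 := by
    intro hs
    apply hq
    ext <;> simp <;> nlinarith [sq_nonneg a, sq_nonneg b, sq_nonneg c, sq_nonneg d]
  have hc : c ^ 2 = a ^ 2 + b ^ 2 - d ^ 2 := by linarith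
  refine ⟨(c * a + d * b) / (a ^ 2 + b ^ 2), (d * a - c * b) / (a ^ 2 + b ^ 2), ?_, fun t => ?_⟩
  · field_simp
    linear_combination (a ^ 2 + b ^ 2) * hc
  · ext <;> simp <;> field_simp
    · linear_combination (-a + t * b) * hc
    · linear_combination (-t * a - b) * hc
    · ring
    · ring

/-- If `r₁` is a simple real root of the companion polynomial of a monic `P` and
`r` is a real number with `C_P(r) ≠ 0`, then `P_r(x) = P(x)(x - r)` has a linear
zero in the quasi-similarity class of `(r + r₁)/2 + ((r - r₁)/2) j`: the zeros of
`P_r` in that class form an infinite set, yet not the whole class. -/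
theorem stmt_19 (P : Polynomial CoQ) (hmonic : P.Monic) (r₁ r : ℝ)
    (hroot : (X - C ((r₁ : ℝ) : CoQ)) ∣ (pconj P * P))
    (hsimple : ¬ (X - C ((r₁ : ℝ) : CoQ)) ^ 2 ∣ (pconj P * P))
    (hr : (pconj P * P).eval ((r : ℝ) : CoQ) ≠ 0) :
    {z : CoQ | z.re = (r + r₁) / 2 ∧ coDet z = r * r₁ ∧
        (P * (X - C ((r : ℝ) : CoQ))).eval z = 0}.Infinite ∧
    ∃ w : CoQ, w.re = (r + r₁) / 2 ∧ coDet w = r * r₁ ∧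
        (P * (X - C ((r : ℝ) : CoQ))).eval w ≠ 0 := by
  set A := P.eval (r₁ : CoQ) with hA
  have hzero : (pconj P * P).eval (r₁ : CoQ) = 0 := by
    obtain ⟨Q, hQ⟩ := hroot
    simp [hQ, eval_mul_real]
  have hne : r₁ - r ≠ 0 := by
    intro h
    obtain rfl : r₁ = r := by linarith
    exact hr hzero
  have hA0 : A ≠ 0 := by
    intro h
    have hP := X_sub_C_real_dvd_of_eval_eq_zero h
    obtain ⟨S, hS⟩ := X_sub_C_real_dvd_pconj hP
    obtain ⟨Q, hQ⟩ := hP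
    refine hsimple ⟨S * Q, ?_⟩
    rw [hS, hQ, mul_assoc, ← mul_assoc S, ← (commute_X_sub_C_real S r₁).eq, sq]
    simp only [mul_assoc]
  have hdet : coDet A = 0 := by
    apply coDet_eq_zero_of_star_mul_self
    rw [← eval_pconj_real, ← eval_mul_real, hzero]
  constructor
  · obtain ⟨c, e, hce, hline⟩ := exists_line_of_coDet_eq_zero hA0 hdet
    let z (t : ℝ) : CoQ := r + ((r₁ - r) / 2) • (⟨1, t, -c - t * e, t * c - e⟩ : CoQ)
    refine Set.infinite_of_injective_forall_mem (f := z) (fun s t hst => ?_) fun t => ?_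
    · have := congrArg QuaternionAlgebra.imI hst
      simpa [z, hne] using this
    · have hre : (z t).re = (r + r₁) / 2 := by simp [z]; ring
      have hz : coDet (z t) = r * r₁ := by
        simp [coDet, z]
        linear_combination -((r₁ - r) / 2) ^ 2 * (1 + t ^ 2) * hce
      refine ⟨hre, hz, ?_⟩
      rw [eval_mul_X_sub_C_real P r r₁ hre hz, add_sub_cancel_left, mul_smul_comm, hline,
        smul_zero]
  · by_contra! hall
    have hj (s : ℝ) (hs : s ^ 2 = 1) :
        A * ((⟨(r + r₁) / 2, 0, s * ((r₁ - r) / 2), 0⟩ : CoQ) - r) = 0 := by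
      have hz : coDet ⟨(r + r₁) / 2, 0, s * ((r₁ - r) / 2), 0⟩ = r * r₁ := by
        simp only [coDet]
        linear_combination -((r₁ - r) / 2) ^ 2 * hs
      rw [← eval_mul_X_sub_C_real P r r₁ rfl hz]
      exact hall _ rfl hz
    have hsum := congrArg₂ (· + ·) (hj 1 (by norm_num)) (hj (-1) (by norm_num))
    have hscalar : (r₁ - r) • A = 0 := by
      rw [← QuaternionAlgebra.coe_mul_eq_smul, QuaternionAlgebra.coe_commutes]
      simp only [← mul_add, add_zero] at hsum
      rw [← hsum]
      congr 1
      ext <;> simp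
      ring
    exact (smul_ne_zero hne hA0) hscalar
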